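/- Let T be a very generic tetrahedron of flags with edge coordinates z_{ij} and face coordinates z_{ijk}, and let T* be its dual. Define β(T) = [z₁₂] + [z₂₁] + [z₃₄] + [z₄₃] in the pre-Bloch group P(C), and similarly β(T*) using the dual edge coordinates. Then in P(C), β(T) = β(T*) + [-z₁₂₃] + [-z₂₄₃] + [-z₁₃₄] + [-z₁₄₂], provided all the bracketed arguments lie in C \ {0,1}. -/

import Mathlib

/-- The set of "admissible" generators: elements of `F \ {0,1}`. -/
abbrev PBG (F : Type*) [Field F] : Type _ := {z : F // z ≠ 0 ∧ z ≠ 1}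

/-- The subgroup of five-term relations in the free abelian group on `F \ {0,1}`. -/
def fiveTermRels (F : Type*) [Field F] : AddSubgroup (FreeAbelianGroup (PBG F)) :=
  AddSubgroup.closure
    { r | ∃ x y a b c : PBG F, x ≠ y ∧
        (a : F) = (y : F) / (x : F) ∧
        (b : F) = (1 - (x : F)⁻¹) / (1 - (y : F)⁻¹) ∧
        (c : F) = (1 - (x : F)) / (1 - (y : F)) ∧
        r = FreeAbelianGroup.of x - FreeAbelianGroup.of y + FreeAbelianGroup.of a
            - FreeAbelianGroup.of b + FreeAbelianGroup.of c }

/-- The pre-Bloch group `P(F)`. -/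
abbrev preBloch (F : Type*) [Field F] :=
  FreeAbelianGroup (PBG F) ⧸ fiveTermRels F

/-- The class `[z]` of a generator in the pre-Bloch group. -/
def pb {F : Type*} [Field F] (z : PBG F) : preBloch F :=
  QuotientAddGroup.mk (FreeAbelianGroup.of z)

/-- Pairing of a covector and a vector in `ℂ³`. -/
noncomputable def dot (f x : Fin 3 → ℂ) : ℂ := ∑ t, f t * x t

/-- Determinant of three vectors of `ℂ³` (as rows). -/
noncomputable def det3 (a b c : Fin 3 → ℂ) : ℂ := Matrix.det (Matrix.of ![a, b, c])

/-- A generic tetrahedron of flags in `ℂP²`: four points `[xᵢ]` and four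
lines `[fᵢ]` with `fᵢ(xᵢ) = 0`, `fᵢ(xⱼ) ≠ 0` for `i ≠ j`, and no three of
the points collinear. -/
structure FlagTetra where
  x : Fin 4 → Fin 3 → ℂ
  f : Fin 4 → Fin 3 → ℂ
  flag : ∀ i, dot (f i) (x i) = 0
  generic_pairing : ∀ i j, i ≠ j → dot (f i) (x j) ≠ 0
  generic_pts : ∀ i j k : Fin 4, i ≠ j → j ≠ k → i ≠ k → det3 (x i) (x j) (x k) ≠ 0

/-- A very generic tetrahedron of flags: in addition no three of the
lines `[fᵢ]` are concurrent. -/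
structure VGTetra extends FlagTetra where
  generic_lines : ∀ i j k : Fin 4, i ≠ j → j ≠ k → i ≠ k → det3 (f i) (f j) (f k) ≠ 0

/-- The edge coordinate `z_{ij}(T)`, computed with respect to an even
permutation `(i,j,k,l)` of the vertices:
`z_{ij} = (fᵢ(x_k)·det(xᵢ,xⱼ,x_l)) / (fᵢ(x_l)·det(xᵢ,xⱼ,x_k))`. -/
noncomputable def zEdge (T : FlagTetra) (i j k l : Fin 4) : ℂ :=
  (dot (T.f i) (T.x k) * det3 (T.x i) (T.x j) (T.x l)) /
    (dot (T.f i) (T.x l) * det3 (T.x i) (T.x j) (T.x k))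

/-- The face coordinate (triple ratio) `z_{ijk}(T)`. -/
noncomputable def zFace (T : FlagTetra) (i j k : Fin 4) : ℂ :=
  (dot (T.f i) (T.x j) * dot (T.f j) (T.x k) * dot (T.f k) (T.x i)) /
    (dot (T.f i) (T.x k) * dot (T.f j) (T.x i) * dot (T.f k) (T.x j))

/-- The edge coordinate `z*_{ij}` of the dual tetrahedron `T*`, obtained by
replacing each flag `([x],[f])` by `([f],[x])` in the dual projective plane. -/
noncomputable def zEdgeDual (T : FlagTetra) (i j k l : Fin 4) : ℂ :=
  (dot (T.f k) (T.x i) * det3 (T.f i) (T.f j) (T.f l)) /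
    (dot (T.f l) (T.x i) * det3 (T.f i) (T.f j) (T.f k))


/-- The class `[z]`, extended by `0` to the degenerate arguments `0, 1`. -/
noncomputable def pbx (z : ℂ) : preBloch ℂ :=
  open Classical in if h : z ≠ 0 ∧ z ≠ 1 then pb ⟨z, h⟩ else 0

lemma pbx_coe (a : PBG ℂ) : pbx (a : ℂ) = pb a := by
  unfold pbx
  rw [dif_pos a.2]

lemma pb_five (x y a b c : PBG ℂ) (hxy : x ≠ y)
    (ha : (a : ℂ) = (y : ℂ) / (x : ℂ))
    (hb : (b : ℂ) = (1 - (x : ℂ)⁻¹) / (1 - (y : ℂ)⁻¹))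
    (hc : (c : ℂ) = (1 - (x : ℂ)) / (1 - (y : ℂ))) :
    pb x - pb y + pb a - pb b + pb c = 0 := by
  have h : FreeAbelianGroup.of x - FreeAbelianGroup.of y + FreeAbelianGroup.of a
            - FreeAbelianGroup.of b + FreeAbelianGroup.of c ∈ fiveTermRels ℂ :=
    AddSubgroup.subset_closure ⟨x, y, a, b, c, hxy, ha, hb, hc, rfl⟩
  exact (QuotientAddGroup.eq_zero_iff _).2 h

/-- Five-term relation for the extended classes. -/
lemma pbx_five (x y : ℂ) (hx0 : x ≠ 0) (hx1 : x ≠ 1) (hy0 : y ≠ 0) (hy1 : y ≠ 1)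
    (hxy : x ≠ y) :
    pbx x - pbx y + pbx (y / x) - pbx ((y * (1 - x)) / (x * (1 - y)))
      + pbx ((1 - x) / (1 - y)) = 0 := by
  have hx1' : 1 - x ≠ 0 := sub_ne_zero.2 (Ne.symm hx1)
  have hy1' : 1 - y ≠ 0 := sub_ne_zero.2 (Ne.symm hy1)
  have h1 : y / x ≠ 0 ∧ y / x ≠ 1 :=
    ⟨div_ne_zero hy0 hx0, fun h => hxy ((div_eq_one_iff_eq hx0).1 h).symm⟩
  have h2 : (y * (1 - x)) / (x * (1 - y)) ≠ 0 ∧ (y * (1 - x)) / (x * (1 - y)) ≠ 1 := by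
    refine ⟨div_ne_zero (mul_ne_zero hy0 hx1') (mul_ne_zero hx0 hy1'), fun h => hxy ?_⟩
    have := (div_eq_one_iff_eq (mul_ne_zero hx0 hy1')).1 h
    linear_combination -this
  have h3 : (1 - x) / (1 - y) ≠ 0 ∧ (1 - x) / (1 - y) ≠ 1 := by
    refine ⟨div_ne_zero hx1' hy1', fun h => hxy ?_⟩
    have := (div_eq_one_iff_eq hy1').1 h
    linear_combination -this
  have key := pb_five ⟨x, hx0, hx1⟩ ⟨y, hy0, hy1⟩ ⟨_, h1⟩ ⟨_, h2⟩ ⟨_, h3⟩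
    (fun h => hxy (congrArg Subtype.val h)) rfl
    (by
      have hy1'' : y - 1 ≠ 0 := sub_ne_zero.2 hy1
      have e1 : 1 - x⁻¹ = -(1 - x) / x := by field_simp; ring
      have e2 : 1 - y⁻¹ = -(1 - y) / y := by field_simp; ring
      show (y * (1 - x)) / (x * (1 - y)) = (1 - x⁻¹) / (1 - y⁻¹)
      rw [e1, e2]
      field_simp) rfl
  simp only [← pbx_coe] at key
  exact key

lemma pbx_zero : pbx 0 = 0 := by simp [pbx]

lemma pbx_one : pbx 1 = 0 := by simp [pbx]

lemma pbx_inv (z : ℂ) : pbx z⁻¹ = -pbx z := by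
  by_cases hz0 : z = 0
  · simp [hz0, pbx_zero]
  by_cases hz1 : z = 1
  · simp [hz1, pbx_one]
  obtain ⟨w, rfl⟩ : ∃ w : ℂ, z = w * w := by
    obtain ⟨w, hw⟩ := IsAlgClosed.exists_pow_nat_eq z (n := 2) (by norm_num)
    exact ⟨w, by rw [← hw]; ring⟩
  have hw0 : w ≠ 0 := fun h => hz0 (by simp [h])
  have hw1 : w ≠ 1 := fun h => hz1 (by simp [h])
  have hww : w ≠ w * w := fun h => hw1 (by
    have : w * (w - 1) = 0 := by linear_combination -h
    rcases mul_eq_zero.1 this with h | h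
    · exact absurd h hw0
    · linear_combination h)
  have hi0 : w⁻¹ ≠ 0 := inv_ne_zero hw0
  have hi1 : w⁻¹ ≠ 1 := fun h => hw1 (inv_eq_one.1 h)
  have hj0 : (w * w)⁻¹ ≠ 0 := inv_ne_zero hz0
  have hj1 : (w * w)⁻¹ ≠ 1 := fun h => hz1 (inv_eq_one.1 h)
  have hij : w⁻¹ ≠ (w * w)⁻¹ := fun h => hww (inv_injective h)
  have hA : 1 - w ≠ 0 := sub_ne_zero.2 (Ne.symm hw1)
  have hB : 1 - w * w ≠ 0 := sub_ne_zero.2 (Ne.symm hz1)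
  have hA' : w - 1 ≠ 0 := sub_ne_zero.2 hw1
  have hB' : w * w - 1 ≠ 0 := sub_ne_zero.2 hz1
  have a1 : 1 - w⁻¹ = -(1 - w) / w := by field_simp; ring
  have a2 : 1 - (w * w)⁻¹ = -(1 - w * w) / (w * w) := by field_simp; ring
  have s1 := pbx_five w (w * w) hw0 hw1 hz0 hz1 hww
  have s2 := pbx_five w⁻¹ (w * w)⁻¹ hi0 hi1 hj0 hj1 hij
  have s3 := pbx_five (w * w) w hz0 hz1 hw0 hw1 hww.symm
  have s4 := pbx_five (w * w)⁻¹ w⁻¹ hj0 hj1 hi0 hi1 hij.symm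
  rw [a1, a2] at s2 s4
  have e1 : w * w / w = w := by field_simp
  have e2 : (w * w)⁻¹ / w⁻¹ = w⁻¹ := by field_simp
  have e3 : w / (w * w) = w⁻¹ := by field_simp
  have e4 : w⁻¹ / (w * w)⁻¹ = w := by field_simp
  have e5 : ((w * w)⁻¹ * (-(1 - w) / w)) / (w⁻¹ * (-(1 - w * w) / (w * w)))
      = (1 - w) / (1 - w * w) := by field_simp
  have e6 : (-(1 - w) / w) / (-(1 - w * w) / (w * w))
      = (w * w * (1 - w)) / (w * (1 - w * w)) := by field_simp
  have e7 : (w⁻¹ * (-(1 - w * w) / (w * w))) / ((w * w)⁻¹ * (-(1 - w) / w))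
      = (1 - w * w) / (1 - w) := by field_simp
  have e8 : (-(1 - w * w) / (w * w)) / (-(1 - w) / w)
      = (w * (1 - w * w)) / (w * w * (1 - w)) := by field_simp
  rw [e1] at s1
  rw [e2, e5, e6] at s2
  rw [e3] at s3
  rw [e4, e7, e8] at s4
  have t1 : pbx w + pbx w⁻¹ - (pbx (w * w) + pbx (w * w)⁻¹) + (pbx w + pbx w⁻¹) = 0 := by
    rw [← add_zero (0 : preBloch ℂ)]
    nth_rewrite 1 [← s1]
    rw [← s2]
    abel
  have t2 : pbx (w * w) + pbx (w * w)⁻¹ = 0 := by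
    rw [← add_zero (0 : preBloch ℂ)]
    nth_rewrite 1 [← s3]
    rw [← s4]
    abel
  exact (neg_eq_of_add_eq_zero_right t2).symm

lemma pbx_compl_const (x y : ℂ) (hx0 : x ≠ 0) (hx1 : x ≠ 1) (hy0 : y ≠ 0) (hy1 : y ≠ 1) :
    pbx x + pbx (1 - x) = pbx y + pbx (1 - y) := by
  by_cases hxy : x = y
  · rw [hxy]
  have hA : 1 - x ≠ 0 := sub_ne_zero.2 (Ne.symm hx1)
  have hB : 1 - y ≠ 0 := sub_ne_zero.2 (Ne.symm hy1)
  have s1 := pbx_five x y hx0 hx1 hy0 hy1 hxy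
  have s2 := pbx_five (1 - y) (1 - x) hB (fun h => hy0 (by linear_combination -h)) hA
    (fun h => hx0 (by linear_combination -h)) (fun h => hxy (by linear_combination h))
  rw [sub_sub_cancel, sub_sub_cancel, mul_comm (1 - x) y, mul_comm (1 - y) x] at s2
  have t : pbx x + pbx (1 - x) - (pbx y + pbx (1 - y)) = 0 := by
    rw [← sub_zero (0 : preBloch ℂ)]
    nth_rewrite 1 [← s1]
    rw [← s2]
    abel
  exact sub_eq_zero.1 t

lemma pbx_compl (x : ℂ) : pbx (1 - x) = -pbx x := by
  by_cases hx0 : x = 0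
  · simp [hx0, pbx_zero, pbx_one]
  by_cases hx1 : x = 1
  · simp [hx1, pbx_zero, pbx_one]
  obtain ⟨w, hw⟩ : ∃ w : ℂ, w * (1 - w) = 1 := by
    obtain ⟨u, hu⟩ := IsAlgClosed.exists_pow_nat_eq (-3 : ℂ) (n := 2) (by norm_num)
    exact ⟨(1 + u) / 2, by linear_combination -hu / 4⟩
  have hw0 : w ≠ 0 := fun h => by simp [h] at hw
  have hw1 : w ≠ 1 := fun h => by simp [h] at hw
  have hi : 1 - w = w⁻¹ := eq_inv_of_mul_eq_one_right hw
  have := pbx_compl_const x w hx0 hx1 hw0 hw1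
  rw [hi, pbx_inv, add_neg_cancel] at this
  exact (neg_eq_of_add_eq_zero_right this).symm

/-- Symmetric (Rogers) form of the five-term relation. -/
lemma pbx_rogers (x y m u v : ℂ) (hx0 : x ≠ 0) (hx1 : x ≠ 1) (hy0 : y ≠ 0) (hy1 : y ≠ 1)
    (hm : m = x * y) (hm1 : m ≠ 1)
    (hu : u * (1 - m) = x * (1 - y)) (hv : v * (1 - m) = y * (1 - x)) :
    pbx x + pbx y = pbx m + pbx u + pbx v := by
  subst hm
  have hM : 1 - x * y ≠ 0 := sub_ne_zero.2 (Ne.symm hm1)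
  have h := pbx_five x (x * y) hx0 hx1 (mul_ne_zero hx0 hy0) hm1 (fun h => hy1 (by
    have : x * (y - 1) = 0 := by linear_combination -h
    rcases mul_eq_zero.1 this with h | h
    · exact absurd h hx0
    · linear_combination h))
  have e1 : x * y / x = y := by field_simp
  have e2 : (x * y * (1 - x)) / (x * (1 - x * y)) = v := by
    rw [div_eq_iff (mul_ne_zero hx0 hM)]
    linear_combination -x * hv
  have e3 : (1 - x) / (1 - x * y) = 1 - u := by
    rw [div_eq_iff hM]
    linear_combination hu
  rw [e1, e2, e3, pbx_compl] at h
  rw [← sub_eq_zero, ← h]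
  abel

/-- `[1/(1-p)] = [p]` and the companion `[-p/(1-p)] = -[p]`. -/
lemma pbx_cycle (p v : ℂ) (h : v * (1 - p) = 1) : pbx v = pbx p := by
  rw [eq_inv_of_mul_eq_one_left h, pbx_inv, pbx_compl, neg_neg]

lemma pbx_cycle_neg (p v : ℂ) (h : (1 - v) * (1 - p) = 1) : pbx v = -pbx p := by
  rw [← pbx_cycle p _ h, pbx_compl, neg_neg]

lemma ne_one_of_sub {u w : ℂ} (hw : w ≠ 0) (h : 1 - u = w) : u ≠ 1 := by
  intro hu
  apply hw
  rw [← h, hu, sub_self]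

/-- The identity when `ab ≠ 1`. -/
lemma beta_generic (a b c d p q r s a' b' c' d' N1 N2 N3 N4 : ℂ)
    (ha : a ≠ 0) (ha1 : 1 - a ≠ 0) (hb : b ≠ 0) (hb1 : 1 - b ≠ 0)
    (hc : c ≠ 0) (hc1 : 1 - c ≠ 0) (hd : d ≠ 0) (hd1 : 1 - d ≠ 0)
    (hN1 : N1 ≠ 0) (hN2 : N2 ≠ 0) (hN3 : N3 ≠ 0) (hN4 : N4 ≠ 0)
    (eN1 : N1 = a * (1 - b) + c * (1 - a)) (eN2 : N2 = d * (1 - c) + b * (1 - d))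
    (eN3 : N3 = c * (1 - d) + a * (1 - c)) (eN4 : N4 = b * (1 - a) + d * (1 - b))
    (hp : p = -((1 - a) * c / (a * (1 - b)))) (hq : q = -((1 - d) * b / (d * (1 - c))))
    (hr : r = -((1 - c) * a / (c * (1 - d)))) (hs : s = -((1 - b) * d / (b * (1 - a))))
    (ha' : a' = c * N4 / N1) (hb' : b' = d * N1 / N4)
    (hc' : c' = a * N2 / N3) (hd' : d' = b * N3 / N2)
    (hP : a * b ≠ 1) :
    pbx a + pbx b + pbx c + pbx d =
      (pbx a' + pbx b' + pbx c' + pbx d') + (pbx p + pbx q + pbx r + pbx s) := by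
  have hP' : 1 - a * b ≠ 0 := sub_ne_zero.2 (Ne.symm hP)
  obtain ⟨P, eP⟩ : ∃ P, P = 1 - a * b := ⟨_, rfl⟩
  have hPn : P ≠ 0 := by rw [eP]; exact hP'
  have oU1 : 1 - N1 / P = (1 - a) * (1 - c) / P := by
    field_simp; rw [eP, eN1]; ring
  have oU4 : 1 - N4 / P = (1 - b) * (1 - d) / P := by
    field_simp; rw [eP, eN4]; ring
  have oV1 : 1 - c * P / N1 = a * (1 - b) * (1 - c) / N1 := by
    field_simp; rw [eP, eN1]; ring
  have oV4 : 1 - d * P / N4 = b * (1 - a) * (1 - d) / N4 := by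
    field_simp; rw [eP, eN4]; ring
  have oa' : 1 - a' = (1 - b) * N3 / N1 := by
    rw [ha']; field_simp; rw [eN1, eN3, eN4]; ring
  have ob' : 1 - b' = (1 - a) * N2 / N4 := by
    rw [hb']; field_simp; rw [eN1, eN2, eN4]; ring
  have oc' : 1 - c' = (1 - d) * N1 / N3 := by
    rw [hc']; field_simp; rw [eN1, eN2, eN3]; ring
  have od' : 1 - d' = (1 - c) * N4 / N2 := by
    rw [hd']; field_simp; rw [eN2, eN3, eN4]; ring
  have op : 1 - p = N1 / (a * (1 - b)) := by
    rw [hp]; field_simp; rw [eN1]; ring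
  have oq : 1 - q = N2 / (d * (1 - c)) := by
    rw [hq]; field_simp; rw [eN2]; ring
  have or' : 1 - r = N3 / (c * (1 - d)) := by
    rw [hr]; field_simp; rw [eN3]; ring
  have os : 1 - s = N4 / (b * (1 - a)) := by
    rw [hs]; field_simp; rw [eN4]; ring
  have nU1 : N1 / P ≠ 1 := ne_one_of_sub (by simp only [ne_eq, div_eq_zero_iff, mul_eq_zero, not_or]; tauto) oU1
  have nU4 : N4 / P ≠ 1 := ne_one_of_sub (by simp only [ne_eq, div_eq_zero_iff, mul_eq_zero, not_or]; tauto) oU4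
  have nV1 : c * P / N1 ≠ 1 := ne_one_of_sub (by simp only [ne_eq, div_eq_zero_iff, mul_eq_zero, not_or]; tauto) oV1
  have nV4 : d * P / N4 ≠ 1 := ne_one_of_sub (by simp only [ne_eq, div_eq_zero_iff, mul_eq_zero, not_or]; tauto) oV4
  have na' : a' ≠ 1 := ne_one_of_sub (by simp only [ne_eq, div_eq_zero_iff, mul_eq_zero, not_or]; tauto) oa'
  have nb' : b' ≠ 1 := ne_one_of_sub (by simp only [ne_eq, div_eq_zero_iff, mul_eq_zero, not_or]; tauto) ob'
  have nc' : c' ≠ 1 := ne_one_of_sub (by simp only [ne_eq, div_eq_zero_iff, mul_eq_zero, not_or]; tauto) oc'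
  have nd' : d' ≠ 1 := ne_one_of_sub (by simp only [ne_eq, div_eq_zero_iff, mul_eq_zero, not_or]; tauto) od'
  have zc' : c' ≠ 0 := by rw [hc']; simp only [ne_eq, div_eq_zero_iff, mul_eq_zero, not_or]; tauto
  have zd' : d' ≠ 0 := by rw [hd']; simp only [ne_eq, div_eq_zero_iff, mul_eq_zero, not_or]; tauto
  have na : a ≠ 1 := ne_one_of_sub ha1 rfl
  have nb : b ≠ 1 := ne_one_of_sub hb1 rfl
  have nc : c ≠ 1 := ne_one_of_sub hc1 rfl
  have nd : d ≠ 1 := ne_one_of_sub hd1 rfl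
  have r0 := pbx_rogers a b (a * b) (a * (1 - b) / P) (b * (1 - a) / P) ha na hb nb rfl hP
    (by rw [← eP]; field_simp) (by rw [← eP]; field_simp)
  have r1 := pbx_rogers (N1 / P) (c * P / N1) c (a * (1 - b) / P) (c * (1 - a) / N1)
    (by simp only [ne_eq, div_eq_zero_iff, mul_eq_zero, not_or]; tauto) nU1 (by simp only [ne_eq, div_eq_zero_iff, mul_eq_zero, not_or]; tauto) nV1 (by field_simp) nc
    (by rw [oV1]; field_simp) (by rw [oU1]; field_simp)
  have r4 := pbx_rogers (N4 / P) (d * P / N4) d (b * (1 - a) / P) (d * (1 - b) / N4)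
    (by simp only [ne_eq, div_eq_zero_iff, mul_eq_zero, not_or]; tauto) nU4 (by simp only [ne_eq, div_eq_zero_iff, mul_eq_zero, not_or]; tauto) nV4 (by field_simp) nd
    (by rw [oV4]; field_simp) (by rw [oU4]; field_simp)
  have r0' := pbx_rogers c' d' (a * b) (a * (1 - c) * N4 / (N3 * P))
    (b * (1 - d) * N1 / (N2 * P)) zc' nc' zd' nd'
    (by rw [hc', hd']; field_simp) hP
    (by rw [od', hc', ← eP]; field_simp) (by rw [oc', hd', ← eP]; field_simp)
  have r1' := pbx_rogers (N4 / P) (c * P / N1) a' (a * (1 - c) * N4 / (N3 * P))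
    (c * (1 - d) / N3)
    (by simp only [ne_eq, div_eq_zero_iff, mul_eq_zero, not_or]; tauto) nU4 (by simp only [ne_eq, div_eq_zero_iff, mul_eq_zero, not_or]; tauto) nV1 (by rw [ha']; field_simp) na'
    (by rw [oV1, oa']; field_simp) (by rw [oU4, oa']; field_simp)
  have r4' := pbx_rogers (N1 / P) (d * P / N4) b' (b * (1 - d) * N1 / (N2 * P))
    (d * (1 - c) / N2)
    (by simp only [ne_eq, div_eq_zero_iff, mul_eq_zero, not_or]; tauto) nU1 (by simp only [ne_eq, div_eq_zero_iff, mul_eq_zero, not_or]; tauto) nV4 (by rw [hb']; field_simp) nb'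
    (by rw [oV4, ob']; field_simp) (by rw [oU1, ob']; field_simp)
  rw [pbx_cycle_neg p (c * (1 - a) / N1) (by
    have : 1 - c * (1 - a) / N1 = a * (1 - b) / N1 := by field_simp; rw [eN1]; ring
    rw [op, this]; field_simp)] at r1
  rw [pbx_cycle_neg s (d * (1 - b) / N4) (by
    have : 1 - d * (1 - b) / N4 = b * (1 - a) / N4 := by field_simp; rw [eN4]; ring
    rw [os, this]; field_simp)] at r4
  rw [pbx_cycle r (c * (1 - d) / N3) (by rw [or']; field_simp)] at r1'
  rw [pbx_cycle q (d * (1 - c) / N2) (by rw [oq]; field_simp)] at r4'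
  rw [← sub_eq_zero] at r0 r1 r4 r0' r1' r4' ⊢
  have t := congrArg₂ (· + ·) (congrArg₂ (· - ·) r0 r0')
    (congrArg₂ (· - ·) (congrArg₂ (· + ·) r1' r4') (congrArg₂ (· + ·) r1 r4))
  simp only [sub_zero, add_zero] at t
  rw [← t]
  abel

lemma pbx_mul_one (x y : ℂ) (h : x * y = 1) : pbx x + pbx y = 0 := by
  rw [eq_inv_of_mul_eq_one_right h, pbx_inv, add_neg_cancel]

lemma beta_all (a b c d p q r s a' b' c' d' N1 N2 N3 N4 : ℂ)
    (ha : a ≠ 0) (ha1 : 1 - a ≠ 0) (hb : b ≠ 0) (hb1 : 1 - b ≠ 0)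
    (hc : c ≠ 0) (hc1 : 1 - c ≠ 0) (hd : d ≠ 0) (hd1 : 1 - d ≠ 0)
    (hN1 : N1 ≠ 0) (hN2 : N2 ≠ 0) (hN3 : N3 ≠ 0) (hN4 : N4 ≠ 0)
    (eN1 : N1 = a * (1 - b) + c * (1 - a)) (eN2 : N2 = d * (1 - c) + b * (1 - d))
    (eN3 : N3 = c * (1 - d) + a * (1 - c)) (eN4 : N4 = b * (1 - a) + d * (1 - b))
    (hp : p = -((1 - a) * c / (a * (1 - b)))) (hq : q = -((1 - d) * b / (d * (1 - c))))
    (hr : r = -((1 - c) * a / (c * (1 - d)))) (hs : s = -((1 - b) * d / (b * (1 - a))))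
    (ha' : a' = c * N4 / N1) (hb' : b' = d * N1 / N4)
    (hc' : c' = a * N2 / N3) (hd' : d' = b * N3 / N2) :
    pbx a + pbx b + pbx c + pbx d =
      (pbx a' + pbx b' + pbx c' + pbx d') + (pbx p + pbx q + pbx r + pbx s) := by
  by_cases hP : a * b = 1
  · by_cases hQ : c * d = 1
    · have t1 := pbx_mul_one a b hP
      have t2 := pbx_mul_one c d hQ
      have t3 := pbx_mul_one a' b' (by rw [← hQ, ha', hb']; field_simp)
      have t4 := pbx_mul_one c' d' (by rw [← hP, hc', hd']; field_simp)
      have t5 := pbx_mul_one p s (by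
        have : p * s = (c * d) / (a * b) := by rw [hp, hs]; field_simp
        rw [this, hP, hQ, div_one])
      have t6 := pbx_mul_one q r (by
        have : q * r = (a * b) / (c * d) := by rw [hq, hr]; field_simp
        rw [this, hP, hQ, div_one])
      have e1 : pbx a + pbx b + pbx c + pbx d = 0 := by
        rw [t1, zero_add, t2]
      have e2 : (pbx a' + pbx b' + pbx c' + pbx d') = 0 := by
        rw [t3, zero_add, t4]
      have e3 : pbx p + pbx q + pbx r + pbx s = (pbx p + pbx s) + (pbx q + pbx r) := by abel
      rw [e1, e2, e3, t5, t6]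
      simp
    · have := beta_generic c d a b r s p q c' d' a' b' N3 N4 N1 N2 hc hc1 hd hd1 ha ha1 hb hb1
        hN3 hN4 hN1 hN2 eN3 (by rw [eN4]) (by rw [eN1]) eN2 hr hs hp hq
        hc' hd' ha' hb' hQ
      rw [← sub_eq_zero] at this ⊢
      rw [← this]
      abel
  · exact beta_generic a b c d p q r s a' b' c' d' N1 N2 N3 N4 ha ha1 hb hb1 hc hc1 hd hd1
      hN1 hN2 hN3 hN4 eN1 eN2 eN3 eN4 hp hq hr hs ha' hb' hc' hd' hP

lemma det3_eq (a b c : Fin 3 → ℂ) : det3 a b c =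
    a 0 * b 1 * c 2 - a 0 * b 2 * c 1 - a 1 * b 0 * c 2 + a 1 * b 2 * c 0
      + a 2 * b 0 * c 1 - a 2 * b 1 * c 0 := by
  simp [det3, Matrix.det_fin_three]

lemma dot_eq (f x : Fin 3 → ℂ) : dot f x = f 0 * x 0 + f 1 * x 1 + f 2 * x 2 := by
  simp [dot, Fin.sum_univ_three]

/-- Linear relation among four vectors of `ℂ³`. -/
lemma four_rel (f x y z w : Fin 3 → ℂ) :
    det3 y z w * dot f x - det3 x z w * dot f y + det3 x y w * dot f z
      - det3 x y z * dot f w = 0 := by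
  simp only [det3_eq, dot_eq]
  ring

/-- Multiplicativity of the determinant for flags. -/
lemma det_mul_flag (f g h x y z : Fin 3 → ℂ) (h1 : dot f x = 0) (h2 : dot g y = 0)
    (h3 : dot h z = 0) :
    det3 f g h * det3 x y z =
      dot f y * dot g z * dot h x + dot f z * dot g x * dot h y := by
  have key : det3 f g h * det3 x y z =
      dot f x * (dot g y * dot h z - dot g z * dot h y)
      - dot f y * (dot g x * dot h z - dot g z * dot h x)
      + dot f z * (dot g x * dot h y - dot g y * dot h x) := by
    simp only [det3_eq, dot_eq]
    ring
  rw [key, h1, h2, h3]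
  ring

lemma det3_swap12 (a b c : Fin 3 → ℂ) : det3 b a c = -det3 a b c := by
  simp only [det3_eq]; ring

lemma det3_rot (a b c : Fin 3 → ℂ) : det3 b c a = det3 a b c := by
  simp only [det3_eq]; ring

lemma det3_rev (a b c : Fin 3 → ℂ) : det3 c b a = -det3 a b c := by
  simp only [det3_eq]; ring

/-- The identity in terms of the pairings `fᵢ(xⱼ)` and the determinants. -/
lemma beta_scalar
    (f12 f13 f14 f21 f23 f24 f31 f32 f34 f41 f42 f43 : ℂ)
    (d123 d124 d134 d234 m123 m124 m134 m234 : ℂ)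
    (h12 : f12 ≠ 0) (h13 : f13 ≠ 0) (h14 : f14 ≠ 0) (h21 : f21 ≠ 0) (h23 : f23 ≠ 0)
    (h24 : f24 ≠ 0) (h31 : f31 ≠ 0) (h32 : f32 ≠ 0) (h34 : f34 ≠ 0) (h41 : f41 ≠ 0)
    (h42 : f42 ≠ 0) (h43 : f43 ≠ 0)
    (hd123 : d123 ≠ 0) (hd124 : d124 ≠ 0) (hd134 : d134 ≠ 0) (hd234 : d234 ≠ 0)
    (hm123 : m123 ≠ 0) (hm124 : m124 ≠ 0) (hm134 : m134 ≠ 0) (hm234 : m234 ≠ 0)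
    (r1 : -(d134 * f12) + d124 * f13 - d123 * f14 = 0)
    (r2 : d234 * f21 + d124 * f23 - d123 * f24 = 0)
    (r3 : d234 * f31 - d134 * f32 - d123 * f34 = 0)
    (r4 : d234 * f41 - d134 * f42 + d124 * f43 = 0)
    (e123 : m123 * d123 = f12 * f23 * f31 + f13 * f21 * f32)
    (e124 : m124 * d124 = f12 * f24 * f41 + f14 * f21 * f42)
    (e134 : m134 * d134 = f13 * f34 * f41 + f14 * f31 * f43)
    (e234 : m234 * d234 = f23 * f34 * f42 + f24 * f32 * f43) :
    pbx (f13 * d124 / (f14 * d123)) + pbx (f24 * d123 / (f23 * d124))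
      + pbx (f31 * d234 / (f32 * d134)) + pbx (f42 * d134 / (f41 * d234)) =
    (pbx (f31 * m124 / (f41 * m123)) + pbx (f42 * m123 / (f32 * m124))
      + pbx (f13 * m234 / (f23 * m134)) + pbx (f24 * m134 / (f14 * m234)))
    + (pbx (-(f12 * f23 * f31 / (f13 * f21 * f32)))
      + pbx (-(f24 * f43 * f32 / (f23 * f42 * f34)))
      + pbx (-(f13 * f34 * f41 / (f14 * f31 * f43)))
      + pbx (-(f14 * f42 * f21 / (f12 * f41 * f24)))) := by
  have oa : 1 - f13 * d124 / (f14 * d123) = -(d134 * f12 / (f14 * d123)) := by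
    field_simp; linear_combination -r1
  have ob : 1 - f24 * d123 / (f23 * d124) = -(d234 * f21 / (f23 * d124)) := by
    field_simp; linear_combination r2
  have oc : 1 - f31 * d234 / (f32 * d134) = -(d123 * f34 / (f32 * d134)) := by
    field_simp; linear_combination -r3
  have od : 1 - f42 * d134 / (f41 * d234) = -(d124 * f43 / (f41 * d234)) := by
    field_simp; linear_combination r4
  have z {u v w t : ℂ} (hu : u ≠ 0) (hv : v ≠ 0) (hw : w ≠ 0) (ht : t ≠ 0) :
      u * v / (w * t) ≠ 0 := div_ne_zero (mul_ne_zero hu hv) (mul_ne_zero hw ht)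
  have z' {u v w t s : ℂ} (hu : u ≠ 0) (hv : v ≠ 0) (hw : w ≠ 0) (ht : t ≠ 0) (hs : s ≠ 0) :
      -(u * v / (w * t * s)) ≠ 0 :=
    neg_ne_zero.2 (div_ne_zero (mul_ne_zero hu hv) (mul_ne_zero (mul_ne_zero hw ht) hs))
  apply beta_all (f13 * d124 / (f14 * d123)) (f24 * d123 / (f23 * d124))
    (f31 * d234 / (f32 * d134)) (f42 * d134 / (f41 * d234)) _ _ _ _ _ _ _ _
    (-(d234 * m123 / (f14 * f23 * f32))) (-(d123 * m234 / (f41 * f32 * f23)))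
    (-(d124 * m134 / (f32 * f41 * f14))) (-(d134 * m124 / (f23 * f14 * f41)))
    (z h13 hd124 h14 hd123) (by rw [oa]; exact neg_ne_zero.2 (z hd134 h12 h14 hd123))
    (z h24 hd123 h23 hd124) (by rw [ob]; exact neg_ne_zero.2 (z hd234 h21 h23 hd124))
    (z h31 hd234 h32 hd134) (by rw [oc]; exact neg_ne_zero.2 (z hd123 h34 h32 hd134))
    (z h42 hd134 h41 hd234) (by rw [od]; exact neg_ne_zero.2 (z hd124 h43 h41 hd234))
    (z' hd234 hm123 h14 h23 h32) (z' hd123 hm234 h41 h32 h23)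
    (z' hd124 hm134 h32 h41 h14) (z' hd134 hm124 h23 h14 h41)
  · rw [oa, ob]; field_simp; linear_combination -e123
  · rw [oc, od]; field_simp; linear_combination -e234
  · rw [oc, od]; field_simp; linear_combination -e134
  · rw [oa, ob]; field_simp; linear_combination -e124
  · rw [oa, ob]; field_simp
  · rw [oc, od]; field_simp
  · rw [oc, od]; field_simp
  · rw [oa, ob]; field_simp
  · field_simp
  · field_simp
  · field_simp
  · field_simp

/-- Duality formula for the pre-Bloch invariant of a very generic tetrahedron
of flags: `β(T) = β(T*) + [-z₁₂₃] + [-z₂₄₃] + [-z₁₃₄] + [-z₁₄₂]` in `P(ℂ)`,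
provided all bracketed arguments lie in `ℂ \ {0,1}`.  (Vertices are indexed
from `0`, and each edge/face coordinate is represented by a generator of the
pre-Bloch group carrying its value.) -/
theorem beta_dual_formula (T : VGTetra)
    (a₁₂ a₂₁ a₃₄ a₄₃ b₁₂ b₂₁ b₃₄ b₄₃ c₁₂₃ c₂₄₃ c₁₃₄ c₁₄₂ : PBG ℂ)
    (ha₁₂ : (a₁₂ : ℂ) = zEdge T.toFlagTetra 0 1 2 3)
    (ha₂₁ : (a₂₁ : ℂ) = zEdge T.toFlagTetra 1 0 3 2)
    (ha₃₄ : (a₃₄ : ℂ) = zEdge T.toFlagTetra 2 3 0 1)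
    (ha₄₃ : (a₄₃ : ℂ) = zEdge T.toFlagTetra 3 2 1 0)
    (hb₁₂ : (b₁₂ : ℂ) = zEdgeDual T.toFlagTetra 0 1 2 3)
    (hb₂₁ : (b₂₁ : ℂ) = zEdgeDual T.toFlagTetra 1 0 3 2)
    (hb₃₄ : (b₃₄ : ℂ) = zEdgeDual T.toFlagTetra 2 3 0 1)
    (hb₄₃ : (b₄₃ : ℂ) = zEdgeDual T.toFlagTetra 3 2 1 0)
    (hc₁₂₃ : (c₁₂₃ : ℂ) = -zFace T.toFlagTetra 0 1 2)
    (hc₂₄₃ : (c₂₄₃ : ℂ) = -zFace T.toFlagTetra 1 3 2)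
    (hc₁₃₄ : (c₁₃₄ : ℂ) = -zFace T.toFlagTetra 0 2 3)
    (hc₁₄₂ : (c₁₄₂ : ℂ) = -zFace T.toFlagTetra 0 3 1) :
    pb a₁₂ + pb a₂₁ + pb a₃₄ + pb a₄₃ =
      (pb b₁₂ + pb b₂₁ + pb b₃₄ + pb b₄₃) +
        (pb c₁₂₃ + pb c₂₄₃ + pb c₁₃₄ + pb c₁₄₂) := by
  rw [← pbx_coe a₁₂, ← pbx_coe a₂₁, ← pbx_coe a₃₄, ← pbx_coe a₄₃, ← pbx_coe b₁₂,
    ← pbx_coe b₂₁, ← pbx_coe b₃₄, ← pbx_coe b₄₃, ← pbx_coe c₁₂₃, ← pbx_coe c₂₄₃,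
    ← pbx_coe c₁₃₄, ← pbx_coe c₁₄₂, ha₁₂, ha₂₁, ha₃₄, ha₄₃, hb₁₂, hb₂₁, hb₃₄, hb₄₃,
    hc₁₂₃, hc₂₄₃, hc₁₃₄, hc₁₄₂]
  have gp := T.generic_pairing
  have gx := T.generic_pts
  have gf := T.generic_lines
  have fl := T.flag
  have key := beta_scalar
    (dot (T.f 0) (T.x 1)) (dot (T.f 0) (T.x 2)) (dot (T.f 0) (T.x 3))
    (dot (T.f 1) (T.x 0)) (dot (T.f 1) (T.x 2)) (dot (T.f 1) (T.x 3))
    (dot (T.f 2) (T.x 0)) (dot (T.f 2) (T.x 1)) (dot (T.f 2) (T.x 3))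
    (dot (T.f 3) (T.x 0)) (dot (T.f 3) (T.x 1)) (dot (T.f 3) (T.x 2))
    (det3 (T.x 0) (T.x 1) (T.x 2)) (det3 (T.x 0) (T.x 1) (T.x 3))
    (det3 (T.x 0) (T.x 2) (T.x 3)) (det3 (T.x 1) (T.x 2) (T.x 3))
    (det3 (T.f 0) (T.f 1) (T.f 2)) (det3 (T.f 0) (T.f 1) (T.f 3))
    (det3 (T.f 0) (T.f 2) (T.f 3)) (det3 (T.f 1) (T.f 2) (T.f 3))
    (gp _ _ (by decide)) (gp _ _ (by decide)) (gp _ _ (by decide)) (gp _ _ (by decide))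
    (gp _ _ (by decide)) (gp _ _ (by decide)) (gp _ _ (by decide)) (gp _ _ (by decide))
    (gp _ _ (by decide)) (gp _ _ (by decide)) (gp _ _ (by decide)) (gp _ _ (by decide))
    (gx _ _ _ (by decide) (by decide) (by decide)) (gx _ _ _ (by decide) (by decide) (by decide))
    (gx _ _ _ (by decide) (by decide) (by decide)) (gx _ _ _ (by decide) (by decide) (by decide))
    (gf _ _ _ (by decide) (by decide) (by decide)) (gf _ _ _ (by decide) (by decide) (by decide))
    (gf _ _ _ (by decide) (by decide) (by decide)) (gf _ _ _ (by decide) (by decide) (by decide))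
    (by
      have h := four_rel (T.f 0) (T.x 0) (T.x 1) (T.x 2) (T.x 3)
      rw [fl 0] at h; linear_combination h)
    (by
      have h := four_rel (T.f 1) (T.x 0) (T.x 1) (T.x 2) (T.x 3)
      rw [fl 1] at h; linear_combination h)
    (by
      have h := four_rel (T.f 2) (T.x 0) (T.x 1) (T.x 2) (T.x 3)
      rw [fl 2] at h; linear_combination h)
    (by
      have h := four_rel (T.f 3) (T.x 0) (T.x 1) (T.x 2) (T.x 3)
      rw [fl 3] at h; linear_combination h)
    (det_mul_flag _ _ _ _ _ _ (fl 0) (fl 1) (fl 2))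
    (det_mul_flag _ _ _ _ _ _ (fl 0) (fl 1) (fl 3))
    (det_mul_flag _ _ _ _ _ _ (fl 0) (fl 2) (fl 3))
    (det_mul_flag _ _ _ _ _ _ (fl 1) (fl 2) (fl 3))
  have hneg (u v w t : ℂ) : u * -v / (w * -t) = u * v / (w * t) := by
    rw [mul_neg, mul_neg, neg_div_neg_eq]
  simp only [zEdge, zEdgeDual, zFace]
  rw [det3_swap12 (T.x 0) (T.x 1) (T.x 2), det3_swap12 (T.x 0) (T.x 1) (T.x 3),
    det3_rot (T.x 1) (T.x 2) (T.x 3), det3_rot (T.x 0) (T.x 2) (T.x 3),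
    det3_rev (T.x 0) (T.x 2) (T.x 3), det3_rev (T.x 1) (T.x 2) (T.x 3),
    det3_swap12 (T.f 0) (T.f 1) (T.f 2), det3_swap12 (T.f 0) (T.f 1) (T.f 3),
    det3_rot (T.f 1) (T.f 2) (T.f 3), det3_rot (T.f 0) (T.f 2) (T.f 3),
    det3_rev (T.f 0) (T.f 2) (T.f 3), det3_rev (T.f 1) (T.f 2) (T.f 3)]
  simp only [hneg]
  exact key
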